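/- arXiv:1112.1628 — 9 statements merged into one kernel-verified Lean document; each statement's English description precedes it below -/
import Mathlib

section
/- Let T > 0, let I be a nonempty finite index set, let α_i > 0 for each i ∈ I, let w_i ∈ (0,1) for each i ∈ I, and let f(w) = -T·ln(w). Then equality (Σ_i α_i w_i f(w_i)) / (Σ_i α_i w_i) = (Σ_i α_i f(w_i)) / (Σ_i α_i) holds if and only if all the w_i are equal, i.e., there exists w* with w_i = w* for every i ∈ I. -/
open Finset

theorem stmt_1 {I : Type*} [Fintype I] [Nonempty I]
    (T : ℝ) (hT : 0 < T)
    (α w : I → ℝ)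
    (hα : ∀ i, 0 < α i)
    (hw : ∀ i, w i ∈ Set.Ioo (0 : ℝ) 1)
    (f : ℝ → ℝ) (hf : ∀ z, f z = -T * Real.log z) :
    (∑ i, α i * w i * f (w i)) / (∑ i, α i * w i) =
        (∑ i, α i * f (w i)) / (∑ i, α i) ↔
      ∃ wstar : ℝ, ∀ i, w i = wstar := by
  have hA : 0 < ∑ i, α i := Finset.sum_pos (fun i _ => hα i) Finset.univ_nonempty
  have hS : 0 < ∑ i, α i * w i :=
    Finset.sum_pos (fun i _ => mul_pos (hα i) (hw i).1) Finset.univ_nonempty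
  constructor
  · intro h
    rw [div_eq_div_iff hS.ne' hA.ne'] at h
    obtain ⟨m, hm⟩ : ∃ m, m = (∑ i, α i * w i) / (∑ i, α i) := ⟨_, rfl⟩
    have hm0 : 0 < m := hm ▸ div_pos hS hA
    have hmS : ∑ i, α i * w i = m * ∑ i, α i := by
      rw [hm]; field_simp
    have h1 : ∑ i, α i * w i * f (w i) = m * ∑ i, α i * f (w i) := by
      rw [hmS] at h
      apply mul_right_cancel₀ hA.ne'
      rw [h]; ring
    have key : ∀ i, w i ≠ m → (w i - m) * (f (w i) - f m) < 0 := by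
      intro i hi
      rw [hf, hf]
      rcases lt_or_gt_of_ne hi with hlt | hgt
      · have := Real.log_lt_log (hw i).1 hlt
        apply mul_neg_of_neg_of_pos (by linarith)
        nlinarith
      · have := Real.log_lt_log hm0 hgt
        apply mul_neg_of_pos_of_neg (by linarith)
        nlinarith
    have hsum : ∑ i, -(α i * ((w i - m) * (f (w i) - f m))) = 0 := by
      have e : ∀ i, -(α i * ((w i - m) * (f (w i) - f m))) =
          m * (α i * f (w i)) - α i * w i * f (w i) + f m * (α i * w i) - f m * m * α i := by
        intro i; ring
      simp only [e, Finset.sum_sub_distrib, Finset.sum_add_distrib, ← Finset.mul_sum]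
      rw [h1, hmS]; ring
    have hnn : ∀ i ∈ Finset.univ, 0 ≤ -(α i * ((w i - m) * (f (w i) - f m))) := by
      intro i _
      by_cases hi : w i = m
      · simp [hi]
      · have := mul_neg_of_pos_of_neg (hα i) (key i hi)
        linarith
    refine ⟨m, fun i => ?_⟩
    by_contra hi
    have h0 := (Finset.sum_eq_zero_iff_of_nonneg hnn).1 hsum i (Finset.mem_univ i)
    have := mul_neg_of_pos_of_neg (hα i) (key i hi)
    linarith
  · rintro ⟨c, hc⟩
    simp only [hc] at hS ⊢
    rw [div_eq_div_iff hS.ne' hA.ne']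
    simp only [← Finset.sum_mul]
    ring
end

section
/- Let T > 0, let Q be a nonempty finite set, let x_p ≥ 1 and G_p > 0 be reals for each p ∈ Q. Then (Σ_{p∈Q} x_p G_p exp(-G_p/T)) / (Σ_{p∈Q} x_p exp(-G_p/T)) ≤ (Σ_{p∈Q} x_p G_p) / (Σ_{p∈Q} x_p), with equality if and only if all the G_p, p ∈ Q, are equal. -/
open Finset

theorem stmt_2 {Q : Type*} [Fintype Q] [Nonempty Q]
    (T : ℝ) (hT : 0 < T)
    (x G : Q → ℝ)
    (hx : ∀ p, 1 ≤ x p)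
    (hG : ∀ p, 0 < G p) :
    (∑ p, x p * G p * Real.exp (-G p / T)) / (∑ p, x p * Real.exp (-G p / T)) ≤
        (∑ p, x p * G p) / (∑ p, x p) ∧
      ((∑ p, x p * G p * Real.exp (-G p / T)) / (∑ p, x p * Real.exp (-G p / T)) =
          (∑ p, x p * G p) / (∑ p, x p) ↔
        ∀ p q : Q, G p = G q) := by
  have hx0 : ∀ p, 0 < x p := fun p => lt_of_lt_of_le one_pos (hx p)
  obtain ⟨E, hE⟩ : ∃ E : Q → ℝ, E = fun p => Real.exp (-G p / T) := ⟨_, rfl⟩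
  have hE' : ∀ p, Real.exp (-G p / T) = E p := fun p => by rw [hE]
  have hE0 : ∀ p, 0 < E p := fun p => by rw [← hE']; exact Real.exp_pos _
  have hmono : ∀ p q, G p < G q → E q < E p := by
    intro p q h
    rw [← hE', ← hE']
    apply Real.exp_lt_exp.2
    exact div_lt_div_of_pos_right (neg_lt_neg h) hT
  simp only [hE']
  have hX : 0 < ∑ p, x p := Finset.sum_pos (fun p _ => hx0 p) Finset.univ_nonempty
  have hB : 0 < ∑ p, x p * E p :=
    Finset.sum_pos (fun p _ => mul_pos (hx0 p) (hE0 p)) Finset.univ_nonempty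
  have hpos : ∀ p q, G p ≠ G q → 0 < x p * x q * ((G p - G q) * (E q - E p)) := by
    intro p q h
    apply mul_pos (mul_pos (hx0 p) (hx0 q))
    rcases lt_or_gt_of_ne h with h | h
    · exact mul_pos_of_neg_of_neg (sub_neg.2 h) (sub_neg.2 (hmono _ _ h))
    · exact mul_pos (sub_pos.2 h) (sub_pos.2 (hmono _ _ h))
  have hnn : ∀ p q, 0 ≤ x p * x q * ((G p - G q) * (E q - E p)) := by
    intro p q
    by_cases h : G p = G q
    · simp [h]
    · exact (hpos p q h).le
  have key : ∑ p, ∑ q, x p * x q * ((G p - G q) * (E q - E p)) =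
      2 * ((∑ p, x p * G p) * (∑ p, x p * E p) -
        (∑ p, x p * G p * E p) * (∑ p, x p)) := by
    have h1 : ∀ p q, x p * x q * ((G p - G q) * (E q - E p)) =
        (x p * G p) * (x q * E q) + (x p * E p) * (x q * G q)
        - (x p * G p * E p) * x q - x p * (x q * G q * E q) := by
      intro p q; ring
    simp only [h1, Finset.sum_sub_distrib, Finset.sum_add_distrib, ← Finset.mul_sum,
      ← Finset.sum_mul]
    ring
  have hS : 0 ≤ ∑ p, ∑ q, x p * x q * ((G p - G q) * (E q - E p)) :=
    Finset.sum_nonneg fun p _ => Finset.sum_nonneg fun q _ => hnn p q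
  refine ⟨?_, ?_⟩
  · rw [div_le_div_iff₀ hB hX]
    linarith
  · rw [div_eq_div_iff hB.ne' hX.ne']
    constructor
    · intro h p q
      by_contra hne
      have h0 : ∑ p, ∑ q, x p * x q * ((G p - G q) * (E q - E p)) = 0 := by
        rw [key, h]; ring
      have h2 := (Finset.sum_eq_zero_iff_of_nonneg
        (fun p _ => Finset.sum_nonneg fun q _ => hnn p q)).1 h0 p (Finset.mem_univ p)
      have h3 := (Finset.sum_eq_zero_iff_of_nonneg
        (fun q _ => hnn p q)).1 h2 q (Finset.mem_univ q)
      exact (hpos p q hne).ne' h3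
    · intro h
      have h0 : ∑ p, ∑ q, x p * x q * ((G p - G q) * (E q - E p)) = 0 :=
        Finset.sum_eq_zero fun p _ => Finset.sum_eq_zero fun q _ => by rw [h p q]; ring
      linarith
end

section
/- In the Beckmann route-flow setup, let T > 0, let x ∈ X with x_p ≥ 1 for all p ∈ P, and suppose G_p(x) > 0 for all p ∈ P. Then Σ_{w∈W} d_w · [ (Σ_{p∈P_w} x_p G_p(x) exp(-G_p(x)/T)) / (Σ_{p∈P_w} x_p exp(-G_p(x)/T)) − (Σ_{p∈P_w} x_p G_p(x)) / (Σ_{p∈P_w} x_p) ] ≤ 0, and equality holds if and only if for every w ∈ W the values G_p(x), p ∈ P_w, are all equal. -/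
open Finset

/-- Beckmann route-flow setup: routes `P` partitioned into classes via `part : P → W`,
edge–route incidence `δ`, edge costs `τ`, edge flows `Θx`, and route costs `G`. -/
noncomputable def routeCost {P E : Type*} [Fintype P] [Fintype E]
    (δ : E → P → ℝ) (τ : E → ℝ → ℝ) (x : P → ℝ) (p : P) : ℝ :=
  ∑ e, δ e p * τ e (∑ q, δ e q * x q)

theorem class_ineq {P : Type*} (s : Finset P) (hs : s.Nonempty) (x g : P → ℝ)
    (hx : ∀ p, 0 < x p) (T : ℝ) (hT : 0 < T) :
    (∑ p ∈ s, x p * g p * Real.exp (-(g p) / T)) / (∑ p ∈ s, x p * Real.exp (-(g p) / T)) -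
      (∑ p ∈ s, x p * g p) / (∑ p ∈ s, x p) ≤ 0 ∧
    ((∑ p ∈ s, x p * g p * Real.exp (-(g p) / T)) / (∑ p ∈ s, x p * Real.exp (-(g p) / T)) -
      (∑ p ∈ s, x p * g p) / (∑ p ∈ s, x p) = 0 ↔ ∀ p ∈ s, ∀ q ∈ s, g p = g q) := by
  have hB : 0 < ∑ p ∈ s, x p * Real.exp (-(g p) / T) :=
    Finset.sum_pos (fun p _ => mul_pos (hx p) (Real.exp_pos _)) hs
  have hX : 0 < ∑ p ∈ s, x p := Finset.sum_pos (fun p _ => hx p) hs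
  obtain ⟨m, hm⟩ : ∃ m, m = (∑ p ∈ s, x p * g p) / (∑ p ∈ s, x p) := ⟨_, rfl⟩
  have hmX : ∑ p ∈ s, x p * g p = m * ∑ p ∈ s, x p := by
    rw [hm]; field_simp
  have hterm : ∀ p, (g p - m) * (Real.exp (-(g p) / T) - Real.exp (-m / T)) ≤ 0 ∧
      ((g p - m) * (Real.exp (-(g p) / T) - Real.exp (-m / T)) = 0 → g p = m) := by
    intro p
    rcases lt_trichotomy (g p) m with h | h | h
    · have h2 : Real.exp (-m / T) < Real.exp (-(g p) / T) := by
        apply Real.exp_lt_exp.mpr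
        exact div_lt_div_of_pos_right (by linarith) hT
      have h3 := mul_neg_of_neg_of_pos (sub_neg.mpr h) (sub_pos.mpr h2)
      exact ⟨h3.le, fun h0 => absurd h0 h3.ne⟩
    · exact ⟨by simp [h], fun _ => h⟩
    · have h2 : Real.exp (-(g p) / T) < Real.exp (-m / T) := by
        apply Real.exp_lt_exp.mpr
        exact div_lt_div_of_pos_right (by linarith) hT
      have h3 := mul_neg_of_pos_of_neg (sub_pos.mpr h) (sub_neg.mpr h2)
      exact ⟨h3.le, fun h0 => absurd h0 h3.ne⟩
  have hkey : ∑ p ∈ s, x p * ((g p - m) * (Real.exp (-(g p) / T) - Real.exp (-m / T))) =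
      (∑ p ∈ s, x p * g p * Real.exp (-(g p) / T)) -
        m * ∑ p ∈ s, x p * Real.exp (-(g p) / T) := by
    have h1 : ∑ p ∈ s, x p * ((g p - m) * (Real.exp (-(g p) / T) - Real.exp (-m / T))) =
      (∑ p ∈ s, x p * g p * Real.exp (-(g p) / T)) -
        m * (∑ p ∈ s, x p * Real.exp (-(g p) / T)) -
        Real.exp (-m / T) * ((∑ p ∈ s, x p * g p) - m * ∑ p ∈ s, x p) := by
      simp only [Finset.mul_sum, ← Finset.sum_sub_distrib]
      exact Finset.sum_congr rfl fun p _ => by ring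
    rw [h1, hmX]; ring
  have hle : ∀ p ∈ s, x p * ((g p - m) * (Real.exp (-(g p) / T) - Real.exp (-m / T))) ≤ 0 :=
    fun p _ => mul_nonpos_of_nonneg_of_nonpos (hx p).le (hterm p).1
  have heq : (∑ p ∈ s, x p * g p * Real.exp (-(g p) / T)) /
      (∑ p ∈ s, x p * Real.exp (-(g p) / T)) - (∑ p ∈ s, x p * g p) / (∑ p ∈ s, x p) =
      (∑ p ∈ s, x p * ((g p - m) * (Real.exp (-(g p) / T) - Real.exp (-m / T)))) /
      (∑ p ∈ s, x p * Real.exp (-(g p) / T)) := by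
    rw [hkey, ← hm, sub_div, mul_div_cancel_right₀ _ hB.ne']
  rw [heq]
  refine ⟨div_nonpos_of_nonpos_of_nonneg (Finset.sum_nonpos hle) hB.le, ?_⟩
  rw [div_eq_zero_iff, or_iff_left hB.ne', Finset.sum_eq_zero_iff_of_nonpos hle]
  constructor
  · intro h
    have h' : ∀ p ∈ s, g p = m := fun p hp =>
      (hterm p).2 ((mul_eq_zero.mp (h p hp)).resolve_left (hx p).ne')
    intro p hp q hq
    rw [h' p hp, h' q hq]
  · intro h p hp
    have : g p = m := by
      rw [hm, eq_div_iff hX.ne', Finset.mul_sum]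
      exact Finset.sum_congr rfl fun q hq => by rw [h p hp q hq]; ring
    simp [this]

theorem stmt_3 {P E W : Type*} [Fintype P] [Fintype E] [Fintype W] [DecidableEq W] [Nonempty P]
    (part : P → W) (hpart : ∀ w : W, ∃ p, part p = w)
    (d : W → ℝ) (hd : ∀ w, 0 < d w)
    (δ : E → P → ℝ) (hδ : ∀ e p, δ e p = 0 ∨ δ e p = 1)
    (τ : E → ℝ → ℝ)
    (T : ℝ) (hT : 0 < T)
    (x : P → ℝ) (hx1 : ∀ p, 1 ≤ x p)
    (hxX : ∀ w : W, ∑ p ∈ univ.filter (fun p => part p = w), x p = d w)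
    (hGpos : ∀ p, 0 < routeCost δ τ x p) :
    (∑ w : W, d w *
        ((∑ p ∈ univ.filter (fun p => part p = w),
            x p * routeCost δ τ x p * Real.exp (-(routeCost δ τ x p) / T)) /
          (∑ p ∈ univ.filter (fun p => part p = w),
            x p * Real.exp (-(routeCost δ τ x p) / T)) -
         (∑ p ∈ univ.filter (fun p => part p = w), x p * routeCost δ τ x p) /
          (∑ p ∈ univ.filter (fun p => part p = w), x p))) ≤ 0 ∧
    ((∑ w : W, d w *
        ((∑ p ∈ univ.filter (fun p => part p = w),
            x p * routeCost δ τ x p * Real.exp (-(routeCost δ τ x p) / T)) /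
          (∑ p ∈ univ.filter (fun p => part p = w),
            x p * Real.exp (-(routeCost δ τ x p) / T)) -
         (∑ p ∈ univ.filter (fun p => part p = w), x p * routeCost δ τ x p) /
          (∑ p ∈ univ.filter (fun p => part p = w), x p))) = 0 ↔
      ∀ w : W, ∀ p q : P, part p = w → part q = w →
        routeCost δ τ x p = routeCost δ τ x q) := by
  have hc := fun w : W => class_ineq (univ.filter (fun p => part p = w))
    (by obtain ⟨p, hp⟩ := hpart w; exact ⟨p, by simp [hp]⟩) x (routeCost δ τ x)
    (fun p => lt_of_lt_of_le one_pos (hx1 p)) T hT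
  have hle := fun (w : W) (_ : w ∈ (univ : Finset W)) =>
    mul_nonpos_of_nonneg_of_nonpos (hd w).le (hc w).1
  refine ⟨Finset.sum_nonpos hle, ?_⟩
  rw [Finset.sum_eq_zero_iff_of_nonpos hle]
  constructor
  · intro h w p q hp hq
    exact (hc w).2.mp ((mul_eq_zero.mp (h w (mem_univ w))).resolve_left (hd w).ne') p
      (by simp [hp]) q (by simp [hq])
  · intro h w _
    rw [(hc w).2.mpr (fun p hp q hq => h w p q (by simpa using hp) (by simpa using hq)), mul_zero]
end

section
/- Let (a_n) be a sequence of nonnegative reals, l > 0, C ≥ 0, and (γ_n) a sequence with 0 < γ_n and l·γ_n ≤ 1 for all n, such that a_{n+1} ≤ (1 − l·γ_n)·a_n + C·γ_n² for all n, Σ_{n=1}^∞ γ_n = ∞ and Σ_{n=1}^∞ γ_n² < ∞. Then a_n → 0 as n → ∞. -/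
theorem stmt_4 (a γ : ℕ → ℝ) (l C : ℝ)
    (hl : 0 < l) (hC : 0 ≤ C)
    (ha : ∀ n, 0 ≤ a n)
    (hγpos : ∀ n, 0 < γ n)
    (hγl : ∀ n, l * γ n ≤ 1)
    (hrec : ∀ n, a (n + 1) ≤ (1 - l * γ n) * a n + C * (γ n) ^ 2)
    (hdiv : ¬ Summable γ)
    (hconv : Summable (fun n => (γ n) ^ 2)) :
    Filter.Tendsto a Filter.atTop (nhds 0) := by
  have hS : Summable (fun n => C * (γ n) ^ 2) := hconv.mul_left C
  have hSb : ∀ n, ∑ k ∈ Finset.range n, C * (γ k) ^ 2 ≤ ∑' k, C * (γ k) ^ 2 := fun n =>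
    hS.sum_le_tsum _ (fun i _ => by positivity)
  have hnn : ∀ n, 0 ≤ γ n * a n := fun n => mul_nonneg (hγpos n).le (ha n)
  have hT : ∀ n, a n + ∑ k ∈ Finset.range n, l * (γ k * a k)
      ≤ a 0 + ∑ k ∈ Finset.range n, C * (γ k) ^ 2 := by
    intro n
    induction n with
    | zero => simp
    | succ n ih =>
      rw [Finset.sum_range_succ, Finset.sum_range_succ]
      have := hrec n
      linarith
  have hsum : Summable (fun n => l * (γ n * a n)) := by
    refine summable_of_sum_range_le (c := a 0 + ∑' k, C * (γ k) ^ 2)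
      (fun n => mul_nonneg hl.le (hnn n)) (fun n => ?_)
    linarith [hT n, hSb n, ha n]
  have hanti : Antitone (fun n => a n - ∑ k ∈ Finset.range n, C * (γ k) ^ 2) := by
    refine antitone_nat_of_succ_le (fun n => ?_)
    rw [Finset.sum_range_succ]
    have := hrec n
    have := mul_nonneg hl.le (hnn n)
    linarith
  have hb := tendsto_atTop_ciInf hanti ⟨-∑' k, C * (γ k) ^ 2, by
    rintro _ ⟨n, rfl⟩
    have := hSb n
    have := ha n
    simp only
    linarith⟩
  have hlim := hb.add hS.hasSum.tendsto_sum_nat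
  simp only [sub_add_cancel] at hlim
  generalize (_ + _ : ℝ) = L at hlim
  have hL : 0 ≤ L := ge_of_tendsto' hlim ha
  rcases hL.eq_or_lt with h | h
  · rwa [← h] at hlim
  · exfalso
    apply hdiv
    obtain ⟨N, hN⟩ := Filter.eventually_atTop.1 (hlim.eventually (lt_mem_nhds (half_lt_self h)))
    have h2 := hsum.mul_left (1 / (l * (L / 2)))
    rw [← summable_nat_add_iff N] at h2 ⊢
    refine Summable.of_nonneg_of_le (fun n => (hγpos _).le) (fun n => ?_) h2
    have h3 := hN (n + N) (by omega)
    rw [one_div, inv_mul_eq_div, le_div_iff₀ (by positivity)]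
    have := mul_le_mul_of_nonneg_left h3.le (mul_pos hl (hγpos (n + N))).le
    linarith
end

section
/- Let (Ω, F, P) be a probability space with a filtration (F_n)_{n∈ℕ}, let (V_n) be a sequence of nonnegative, integrable random variables adapted to (F_n), and let (β_n) be nonnegative reals with Σ_{k=n₀}^∞ β_k < ∞, such that E[V_{n+1} | F_n] ≤ V_n + β_n almost surely for every n ≥ n₀. Then for every ε > 0, P( V_n ≤ ε for all n ≥ n₀ ) ≥ 1 − ε^{-1}·( E[V_{n₀}] + Σ_{k=n₀}^∞ β_k ). -/
open MeasureTheory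

lemma split_aux {Ω : Type*} {mΩ : MeasurableSpace Ω} {μ : Measure Ω}
    [IsProbabilityMeasure μ] (f : Ω → ℝ) (hf : Measurable f) (hi : Integrable f μ)
    (ε : ℝ) (S : Set Ω) (hS : MeasurableSet S) :
    ε * (μ.real S - μ.real (S ∩ {ω | f ω ≤ ε})) + ∫ ω in S ∩ {ω | f ω ≤ ε}, f ω ∂μ
      ≤ ∫ ω in S, f ω ∂μ := by
  have hT : MeasurableSet {ω | f ω ≤ ε} := measurableSet_le hf measurable_const
  have h1 := integral_inter_add_sdiff (μ := μ) (f := f) (s := S) hT hi.integrableOn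
  have h2 := measureReal_inter_add_sdiff (μ := μ) (s := S) hT
  have h3 : ∫ ω in S \ {ω | f ω ≤ ε}, ε ∂μ ≤ ∫ ω in S \ {ω | f ω ≤ ε}, f ω ∂μ := by
    refine setIntegral_mono_on (integrable_const _).integrableOn hi.integrableOn (hS.diff hT) ?_
    intro x hx
    have := hx.2
    simp only [Set.mem_ofPred_eq, not_le] at this
    exact this.le
  rw [setIntegral_const, smul_eq_mul] at h3
  rw [← h1, ← h2]
  linarith

theorem stmt_5 {Ω : Type*} {mΩ : MeasurableSpace Ω} {μ : Measure Ω}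
    [IsProbabilityMeasure μ]
    (ℱ : Filtration ℕ mΩ)
    (V : ℕ → Ω → ℝ) (β : ℕ → ℝ) (n₀ : ℕ)
    (hadapted : Adapted ℱ V)
    (hnn : ∀ n ω, 0 ≤ V n ω)
    (hint : ∀ n, Integrable (V n) μ)
    (hβ : ∀ n, 0 ≤ β n)
    (hβsum : Summable (fun k => β (n₀ + k)))
    (hsup : ∀ n, n₀ ≤ n → μ[V (n + 1)|ℱ n] ≤ᵐ[μ] fun ω => V n ω + β n)
    (ε : ℝ) (hε : 0 < ε) :
    1 - ε⁻¹ * ((∫ ω, V n₀ ω ∂μ) + ∑' k, β (n₀ + k)) ≤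
      (μ {ω | ∀ n, n₀ ≤ n → V n ω ≤ ε}).toReal := by
  let G : ℕ → Set Ω := fun k => {ω | ∀ j, j < k → V (n₀ + j) ω ≤ ε}
  have hGs : ∀ k, G (k + 1) = G k ∩ {ω | V (n₀ + k) ω ≤ ε} := by
    intro k
    ext ω
    simp only [G, Set.mem_ofPred_eq, Set.mem_inter_iff, Nat.lt_succ_iff_lt_or_eq]
    constructor
    · exact fun h => ⟨fun j hj => h j (Or.inl hj), h k (Or.inr rfl)⟩
    · rintro ⟨h1, h2⟩ j (hj | rfl)
      · exact h1 j hj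
      · exact h2
  have hGm : ∀ k, MeasurableSet[ℱ (n₀ + k)] (G (k + 1)) := by
    intro k
    have : G (k + 1) = ⋂ j, ⋂ (_ : j < k + 1), {ω | V (n₀ + j) ω ≤ ε} := by
      ext ω; simp [G]
    rw [this]
    refine MeasurableSet.iInter fun j => MeasurableSet.iInter fun hj => ?_
    exact ℱ.mono (by omega : n₀ + j ≤ n₀ + k) _
      (@measurableSet_le _ _ _ _ _ (_) _ _ _ _ _ (hadapted (n₀ + j)) measurable_const)
  have hG0 : G 0 = Set.univ := by ext; simp [G]
  have hGm' : ∀ k, MeasurableSet (G k) := by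
    intro k
    cases k with
    | zero => rw [hG0]; exact MeasurableSet.univ
    | succ k => exact ℱ.le _ _ (hGm k)
  have key : ∀ k, ε * (1 - μ.real (G k)) + ∫ ω in G k, V (n₀ + k) ω ∂μ
      ≤ (∫ ω, V n₀ ω ∂μ) + ∑ j ∈ Finset.range k, β (n₀ + j) := by
    intro k
    induction k with
    | zero => simp [hG0]
    | succ k ih =>
      have h1 := split_aux (μ := μ) (V (n₀ + k)) ((hadapted (n₀ + k)).mono (ℱ.le _) le_rfl)
        (hint _) ε (G k) (hGm' k)
      rw [← hGs] at h1
      have h2 : ∫ ω in G (k + 1), V (n₀ + (k + 1)) ω ∂μ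
          ≤ (∫ ω in G (k + 1), V (n₀ + k) ω ∂μ) + β (n₀ + k) := by
        have e := setIntegral_condExp (μ := μ) (ℱ.le (n₀ + k)) (hint (n₀ + k + 1)) (hGm k)
        change ∫ ω in G (k + 1), V (n₀ + k + 1) ω ∂μ ≤ _
        rw [← e]
        calc _ ≤ ∫ ω in G (k + 1), (V (n₀ + k) ω + β (n₀ + k)) ∂μ :=
              setIntegral_mono_ae integrable_condExp.integrableOn
                ((hint _).add (integrable_const _)).integrableOn (hsup _ (by omega))
          _ = (∫ ω in G (k + 1), V (n₀ + k) ω ∂μ) + μ.real (G (k + 1)) * β (n₀ + k) := by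
              rw [integral_add (hint _).integrableOn (integrable_const _).integrableOn,
                setIntegral_const, smul_eq_mul]
          _ ≤ _ := by
              have := mul_le_mul_of_nonneg_right (measureReal_le_one (μ := μ) (s := G (k + 1)))
                (hβ (n₀ + k))
              linarith
      rw [Finset.sum_range_succ]
      linarith
  have hset : {ω | ∀ n, n₀ ≤ n → V n ω ≤ ε} = ⋂ k, G k := by
    ext ω
    simp only [G, Set.mem_ofPred_eq, Set.mem_iInter]
    constructor
    · exact fun h k j _ => h _ (by omega)
    · intro h n hn
      have := h (n - n₀ + 1) (n - n₀) (by omega)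
      rwa [Nat.add_sub_cancel' hn] at this
  have hlim : Filter.Tendsto (fun k => (μ (G k)).toReal) Filter.atTop
      (nhds (μ (⋂ k, G k)).toReal) := by
    refine (ENNReal.tendsto_toReal (measure_ne_top _ _)).comp
      (tendsto_measure_iInter_atTop (fun k => (hGm' k).nullMeasurableSet) ?_
        ⟨0, measure_ne_top _ _⟩)
    intro a b hab ω h j hj
    exact h j (lt_of_lt_of_le hj hab)
  rw [hset]
  refine ge_of_tendsto' hlim fun k => ?_
  have h1 := key k
  have h2 : 0 ≤ ∫ ω in G k, V (n₀ + k) ω ∂μ := integral_nonneg fun ω => hnn _ ω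
  have h3 := hβsum.sum_le_tsum (Finset.range k) (fun j _ => hβ _)
  have h4 : 1 - μ.real (G k) ≤ ε⁻¹ * ((∫ ω, V n₀ ω ∂μ) + ∑' k, β (n₀ + k)) := by
    rw [le_inv_mul_iff₀ hε]
    linarith
  change _ ≤ μ.real (G k)
  linarith
end

section
/- Let n ≥ 1, let L_i > 0, W_j > 0 with Σ_i L_i = Σ_j W_j = N, and c_ij ≥ 0. Suppose there exist real numbers λ_1,…,λ_n and μ_1,…,μ_n such that the matrix x_ij = exp(−1 − λ_i − μ_j − 2c_ij) satisfies Σ_j x_ij = L_i for all i and Σ_i x_ij = W_j for all j. Then x is the unique minimizer of the entropy functional f over the transportation polytope A. -/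
open Finset

/-- The transportation polytope `A` with row sums `L` and column sums `W`. -/
def inPolytope {n : ℕ} (L W : Fin n → ℝ) (x : Fin n → Fin n → ℝ) : Prop :=
  (∀ i j, 0 ≤ x i j) ∧ (∀ i, ∑ j, x i j = L i) ∧ (∀ j, ∑ i, x i j = W j)

/-- The entropy functional `f(x) = Σ_{i,j} x_ij ln x_ij + 2 Σ_{i,j} c_ij x_ij`
(with the convention `0 · ln 0 = 0`, which holds since `Real.log 0 = 0`). -/
noncomputable def entFun {n : ℕ} (c : Fin n → Fin n → ℝ)
    (x : Fin n → Fin n → ℝ) : ℝ :=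
  (∑ i, ∑ j, x i j * Real.log (x i j)) + 2 * ∑ i, ∑ j, c i j * x i j

theorem gibbs_aux (y l : ℝ) (hy : 0 ≤ y) :
    0 ≤ y * Real.log y - y * l - y + Real.exp l ∧
      (y * Real.log y - y * l - y + Real.exp l = 0 → y = Real.exp l) := by
  rcases hy.eq_or_lt with h | h
  · subst h
    have := Real.exp_pos l
    constructor
    · simp [this.le]
    · intro h
      simp at h
  · have key : Real.exp l = y * Real.exp (l - Real.log y) := by
      rw [Real.exp_sub, Real.exp_log h]
      field_simp
    constructor
    · have h1 := Real.add_one_le_exp (l - Real.log y)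
      have h2 := mul_le_mul_of_nonneg_left h1 hy
      rw [key]
      linarith
    · intro h0
      by_contra hne
      have hne' : l - Real.log y ≠ 0 := by
        intro h3
        apply hne
        rw [key, h3]
        simp
      have h1 := Real.add_one_lt_exp hne'
      have h2 := mul_lt_mul_of_pos_left h1 h
      rw [key] at h0
      linarith

theorem stmt_7 (n : ℕ) (hn : 1 ≤ n)
    (L W : Fin n → ℝ) (c : Fin n → Fin n → ℝ) (N : ℝ)
    (hL : ∀ i, 0 < L i) (hW : ∀ j, 0 < W j)
    (hLN : ∑ i, L i = N) (hWN : ∑ j, W j = N)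
    (hc : ∀ i j, 0 ≤ c i j)
    (x : Fin n → Fin n → ℝ)
    (hx : ∃ lam mu : Fin n → ℝ,
      (∀ i j, x i j = Real.exp (-1 - lam i - mu j - 2 * c i j)) ∧
      (∀ i, ∑ j, x i j = L i) ∧ (∀ j, ∑ i, x i j = W j)) :
    inPolytope L W x ∧
      (∀ y, inPolytope L W y → entFun c x ≤ entFun c y) ∧
      (∀ y, inPolytope L W y →
        (∀ z, inPolytope L W z → entFun c y ≤ entFun c z) → y = x) := by
  obtain ⟨lam, mu, hxe, hr, hcl⟩ := hx
  have hxA : inPolytope L W x :=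
    ⟨fun i j => by rw [hxe]; exact (Real.exp_pos _).le, hr, hcl⟩
  let D : (Fin n → Fin n → ℝ) → Fin n → Fin n → ℝ := fun y i j =>
    y i j * Real.log (y i j) - y i j * (-1 - lam i - mu j - 2 * c i j) - y i j
      + Real.exp (-1 - lam i - mu j - 2 * c i j)
  have hD : ∀ y, inPolytope L W y → entFun c y =
      (∑ i, ∑ j, D y i j) - (∑ i, lam i * L i) - (∑ j, mu j * W j) - N := by
    intro y hy
    obtain ⟨h0, h1, h2⟩ := hy
    have e1 : ∑ i, lam i * L i = ∑ i, ∑ j, lam i * y i j := by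
      simp_rw [← Finset.mul_sum, h1]
    have e2 : ∑ j, mu j * W j = ∑ i, ∑ j, mu j * y i j := by
      rw [Finset.sum_comm]
      simp_rw [← Finset.mul_sum, h2]
    have e3 : N = ∑ i, ∑ j, x i j := by
      simp_rw [hr, hLN]
    rw [e1, e2, e3]
    unfold entFun
    simp_rw [Finset.mul_sum, ← Finset.sum_add_distrib, ← Finset.sum_sub_distrib]
    refine Finset.sum_congr rfl fun i _ => Finset.sum_congr rfl fun j _ => ?_
    simp only [D]
    rw [hxe i j]
    ring
  have hDx : ∑ i, ∑ j, D x i j = 0 := by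
    refine Finset.sum_eq_zero fun i _ => Finset.sum_eq_zero fun j _ => ?_
    simp only [D]
    rw [hxe i j, Real.log_exp]
    ring
  have hnn : ∀ y, inPolytope L W y → ∀ i j, 0 ≤ D y i j := fun y hy i j =>
    (gibbs_aux _ _ (hy.1 i j)).1
  refine ⟨hxA, ?_, ?_⟩
  · intro y hy
    rw [hD x hxA, hD y hy, hDx]
    have : 0 ≤ ∑ i, ∑ j, D y i j :=
      Finset.sum_nonneg fun i _ => Finset.sum_nonneg fun j _ => hnn y hy i j
    linarith
  · intro y hy hmin
    have h := hmin x hxA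
    rw [hD x hxA, hD y hy, hDx] at h
    have hs : ∀ i, 0 ≤ ∑ j, D y i j := fun i => Finset.sum_nonneg fun j _ => hnn y hy i j
    have h0 : ∑ i, ∑ j, D y i j = 0 :=
      le_antisymm (by linarith) (Finset.sum_nonneg fun i _ => hs i)
    funext i j
    have h1 := (Finset.sum_eq_zero_iff_of_nonneg fun i _ => hs i).1 h0 i (Finset.mem_univ i)
    have h2 := (Finset.sum_eq_zero_iff_of_nonneg fun j _ => hnn y hy i j).1 h1 j
      (Finset.mem_univ j)
    rw [hxe i j]
    exact (gibbs_aux _ _ (hy.1 i j)).2 h2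
end

section
/- Let n ≥ 1, let L_i > 0, W_j > 0 with Σ_i L_i = Σ_j W_j = N, and c_ij ≥ 0. Let x* be a minimizer of the entropy functional f over the transportation polytope A with x*_ij > 0 for all i, j. Then for every x ∈ A: f(x) − f(x*) ≥ Σ_{i,j} (x_ij − x*_ij)² / (2·max{x_ij, x*_ij}). -/
open Finset

lemma aux_log_le (u : ℝ) (hu : 1 ≤ u) : Real.log u ≤ (u - u⁻¹) / 2 := by
  have h := Real.self_le_sinh_iff.2 (Real.log_nonneg hu)
  rwa [Real.sinh_log (by linarith)] at h

lemma aux_log_ge (w : ℝ) (h0 : 0 ≤ w) (h1 : w < 1) :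
    w + w ^ 2 / 2 ≤ -Real.log (1 - w) := by
  have h := Real.hasSum_pow_div_log_of_abs_lt_one (x := w) (by rw [abs_of_nonneg h0]; exact h1)
  have h2 := sum_le_hasSum (Finset.range 2) (fun i _ => by positivity) h
  simp [Finset.sum_range_succ] at h2
  norm_num at h2
  linarith

lemma aux_upper (a y : ℝ) (ha : 0 ≤ a) (hy : 0 < y) :
    a * Real.log a - y * Real.log y - (Real.log y + 1) * (a - y) ≤ (a - y) ^ 2 / y := by
  rcases ha.eq_or_lt with rfl | ha
  · simp
    field_simp
    nlinarith
  · have h := Real.log_le_sub_one_of_pos (div_pos ha hy)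
    rw [Real.log_div ha.ne' hy.ne'] at h
    have h2 := mul_le_mul_of_nonneg_left h ha.le
    have h3 : (a - y) ^ 2 / y = a * (a / y - 1) - (a - y) := by field_simp
    rw [h3]; nlinarith

lemma aux_lower (x y : ℝ) (hx : 0 ≤ x) (hy : 0 < y) :
    (x - y) ^ 2 / (2 * max x y) ≤
      x * Real.log x - y * Real.log y - (Real.log y + 1) * (x - y) := by
  rcases hx.eq_or_lt with rfl | hx
  · rw [max_eq_right hy.le]
    have : (0 - y) ^ 2 / (2 * y) = y / 2 := by field_simp; ring
    rw [this]; simp; nlinarith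
  · rcases le_total x y with hxy | hxy
    · rw [max_eq_right hxy]
      have h := aux_log_le (y / x) ((one_le_div hx).2 hxy)
      rw [Real.log_div hy.ne' hx.ne', inv_div] at h
      have h2 := mul_le_mul_of_nonneg_left h hx.le
      have h3 : (x - y) ^ 2 / (2 * y) = y - x - x * ((y / x - x / y) / 2) := by
        field_simp; ring
      rw [h3]; nlinarith
    · rw [max_eq_left hxy]
      have h := aux_log_ge (1 - y / x) (by rw [sub_nonneg, div_le_one hx]; exact hxy)
        (by have := div_pos hy hx; linarith)
      rw [sub_sub_cancel, Real.log_div hy.ne' hx.ne'] at h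
      have h2 := mul_le_mul_of_nonneg_left h hx.le
      have h3 : (x - y) ^ 2 / (2 * x) =
          x * (1 - y / x + (1 - y / x) ^ 2 / 2) - (x - y) := by
        field_simp; ring
      rw [h3]; nlinarith

lemma aux_lim (D K : ℝ) (h : ∀ t : ℝ, 0 < t → t ≤ 1 → 0 ≤ t * D + t ^ 2 * K) : 0 ≤ D := by
  by_contra hD
  push Not at hD
  have hp : 0 < |K| + 1 + -D := by have := abs_nonneg K; linarith
  have ht : 0 < -D / (|K| + 1 + -D) := div_pos (by linarith) hp
  have h1 := h _ ht (by rw [div_le_one hp]; have := abs_nonneg K; linarith)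
  set t := -D / (|K| + 1 + -D) with hdef
  have e : t * (|K| + 1 + -D) = -D := by rw [hdef]; field_simp
  have h2 : 0 ≤ D + t * K := by
    by_contra h3
    push Not at h3
    nlinarith [mul_neg_of_pos_of_neg ht h3]
  nlinarith [mul_le_mul_of_nonneg_left (le_abs_self K) ht.le, mul_pos ht (neg_pos.2 hD)]

lemma aux_diff {n : ℕ} (c x y : Fin n → Fin n → ℝ) :
    entFun c x - entFun c y =
      ∑ i, ∑ j, (x i j * Real.log (x i j) - y i j * Real.log (y i j)
        - (Real.log (y i j) + 1) * (x i j - y i j)) +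
      ∑ i, ∑ j, (Real.log (y i j) + 1 + 2 * c i j) * (x i j - y i j) := by
  unfold entFun
  simp only [Finset.mul_sum, ← Finset.sum_add_distrib, ← Finset.sum_sub_distrib]
  refine Finset.sum_congr rfl fun i _ => Finset.sum_congr rfl fun j _ => ?_
  ring

theorem stmt_9 (n : ℕ) (hn : 1 ≤ n)
    (L W : Fin n → ℝ) (c : Fin n → Fin n → ℝ) (N : ℝ)
    (hL : ∀ i, 0 < L i) (hW : ∀ j, 0 < W j)
    (hLN : ∑ i, L i = N) (hWN : ∑ j, W j = N)
    (hc : ∀ i j, 0 ≤ c i j)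
    (xstar : Fin n → Fin n → ℝ)
    (hxstarA : inPolytope L W xstar)
    (hxstarmin : ∀ x, inPolytope L W x → entFun c xstar ≤ entFun c x)
    (hxstarpos : ∀ i j, 0 < xstar i j)
    (x : Fin n → Fin n → ℝ) (hx : inPolytope L W x) :
    ∑ i, ∑ j, (x i j - xstar i j) ^ 2 / (2 * max (x i j) (xstar i j)) ≤
      entFun c x - entFun c xstar := by
  have hD : 0 ≤ ∑ i, ∑ j, (Real.log (xstar i j) + 1 + 2 * c i j) * (x i j - xstar i j) := by
    apply aux_lim _ (∑ i, ∑ j, (x i j - xstar i j) ^ 2 / xstar i j)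
    intro t ht0 ht1
    have hz : inPolytope L W (fun i j => xstar i j + t * (x i j - xstar i j)) := by
      refine ⟨fun i j => ?_, fun i => ?_, fun j => ?_⟩
      · nlinarith [mul_nonneg ht0.le (hx.1 i j),
          mul_nonneg (sub_nonneg.2 ht1) (hxstarA.1 i j)]
      · rw [Finset.sum_add_distrib, ← Finset.mul_sum, Finset.sum_sub_distrib,
          hx.2.1, hxstarA.2.1]
        ring
      · rw [Finset.sum_add_distrib, ← Finset.mul_sum, Finset.sum_sub_distrib,
          hx.2.2, hxstarA.2.2]
        ring
    have h1 := sub_nonneg.2 (hxstarmin _ hz)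
    rw [aux_diff] at h1
    refine h1.trans ?_
    rw [add_comm]
    simp only [Finset.mul_sum]
    refine add_le_add (le_of_eq ?_) ?_
    · refine Finset.sum_congr rfl fun i _ => Finset.sum_congr rfl fun j _ => ?_
      ring
    · refine Finset.sum_le_sum fun i _ => Finset.sum_le_sum fun j _ => ?_
      refine (aux_upper _ _ (hz.1 i j) (hxstarpos i j)).trans (le_of_eq ?_)
      ring
  rw [aux_diff]
  refine le_add_of_le_of_nonneg ?_ hD
  exact Finset.sum_le_sum fun i _ => Finset.sum_le_sum fun j _ =>
    aux_lower _ _ (hx.1 i j) (hxstarpos i j)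
end

section
/- Let n ≥ 1, let c_ij ≥ 0 be reals, p^L > 0, and define π(x) = Π_{i,j} exp(−2 c_ij x_ij) / (x_ij!) for an n×n matrix x of natural numbers, and exchange rates r(k,m;p,q) = p^L · exp((c_km + c_pq) − (c_pm + c_kq)). Let k, m, p, q ∈ {1,…,n} with k ≠ p and m ≠ q, and let x be a natural-number matrix with x_pm ≥ 1 and x_kq ≥ 1. Define x' by x'_km = x_km + 1, x'_pq = x_pq + 1, x'_pm = x_pm − 1, x'_kq = x_kq − 1, and x'_ij = x_ij otherwise. Then the detailed balance identity holds: (x_km + 1)·(x_pq + 1)·π(x')·r(k,m;p,q) = x_pm·x_kq·π(x)·r(p,m;k,q). -/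
open Finset

/-- Stationary weight `π(x) = Π_{i,j} exp(−2 c_ij x_ij)/(x_ij!)`. -/
noncomputable def statWeight {n : ℕ} (c : Fin n → Fin n → ℝ)
    (x : Fin n → Fin n → ℕ) : ℝ :=
  ∏ i, ∏ j, Real.exp (-2 * c i j * (x i j : ℝ)) / (Nat.factorial (x i j) : ℝ)

/-- Exchange rate `r(k,m;p,q) = p^L · exp((c_km + c_pq) − (c_pm + c_kq))`. -/
noncomputable def exchRate {n : ℕ} (c : Fin n → Fin n → ℝ) (pL : ℝ)
    (k m p q : Fin n) : ℝ :=
  pL * Real.exp ((c k m + c p q) - (c p m + c k q))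

theorem stmt_11 (n : ℕ) (hn : 1 ≤ n)
    (c : Fin n → Fin n → ℝ) (hc : ∀ i j, 0 ≤ c i j)
    (pL : ℝ) (hpL : 0 < pL)
    (k m p q : Fin n) (hkp : k ≠ p) (hmq : m ≠ q)
    (x : Fin n → Fin n → ℕ)
    (hxpm : 1 ≤ x p m) (hxkq : 1 ≤ x k q)
    (x' : Fin n → Fin n → ℕ)
    (hx' : ∀ i j, x' i j =
      if i = k ∧ j = m then x k m + 1
      else if i = p ∧ j = q then x p q + 1
      else if i = p ∧ j = m then x p m - 1
      else if i = k ∧ j = q then x k q - 1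
      else x i j) :
    ((x k m : ℝ) + 1) * ((x p q : ℝ) + 1) * statWeight c x' * exchRate c pL k m p q =
      (x p m : ℝ) * (x k q : ℝ) * statWeight c x * exchRate c pL p m k q := by
  have split : ∀ y : Fin n → Fin n → ℕ, statWeight c y =
      (∏ a ∈ univ \ ({(k,m),(p,q),(p,m),(k,q)} : Finset (Fin n × Fin n)),
        Real.exp (-2 * c a.1 a.2 * (y a.1 a.2 : ℝ)) / (Nat.factorial (y a.1 a.2) : ℝ)) *
      ((Real.exp (-2 * c k m * (y k m : ℝ)) / (Nat.factorial (y k m) : ℝ)) *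
      ((Real.exp (-2 * c p q * (y p q : ℝ)) / (Nat.factorial (y p q) : ℝ)) *
      ((Real.exp (-2 * c p m * (y p m : ℝ)) / (Nat.factorial (y p m) : ℝ)) *
      (Real.exp (-2 * c k q * (y k q : ℝ)) / (Nat.factorial (y k q) : ℝ))))) := by
    intro y
    unfold statWeight
    rw [← Fintype.prod_prod_type' (f := fun i j =>
      Real.exp (-2 * c i j * (y i j : ℝ)) / (Nat.factorial (y i j) : ℝ)),
      ← Finset.prod_sdiff (Finset.subset_univ
        ({(k,m),(p,q),(p,m),(k,q)} : Finset (Fin n × Fin n)))]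
    congr 1
    rw [Finset.prod_insert, Finset.prod_insert, Finset.prod_insert, Finset.prod_singleton]
    all_goals simp [hkp, hmq, hkp.symm, hmq.symm]
  have hrest : (∏ a ∈ univ \ ({(k,m),(p,q),(p,m),(k,q)} : Finset (Fin n × Fin n)),
        Real.exp (-2 * c a.1 a.2 * (x' a.1 a.2 : ℝ)) / (Nat.factorial (x' a.1 a.2) : ℝ)) =
      (∏ a ∈ univ \ ({(k,m),(p,q),(p,m),(k,q)} : Finset (Fin n × Fin n)),
        Real.exp (-2 * c a.1 a.2 * (x a.1 a.2 : ℝ)) / (Nat.factorial (x a.1 a.2) : ℝ)) := by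
    apply Finset.prod_congr rfl
    rintro ⟨i, j⟩ ha
    simp only [mem_sdiff, mem_univ, true_and, mem_insert, mem_singleton, Prod.mk.injEq,
      not_or] at ha
    have : x' i j = x i j := by
      rw [hx', if_neg ha.1, if_neg ha.2.1, if_neg ha.2.2.1, if_neg ha.2.2.2]
    simp only [this]
  have h1 : x' k m = x k m + 1 := by simp [hx']
  have h2 : x' p q = x p q + 1 := by simp [hx', hkp.symm]
  have h3 : x' p m = x p m - 1 := by simp [hx', hkp.symm, hmq]
  have h4 : x' k q = x k q - 1 := by simp [hx', hkp, hmq.symm]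
  rw [split x', split x, hrest, h1, h2, h3, h4]
  generalize (∏ a ∈ univ \ ({(k,m),(p,q),(p,m),(k,q)} : Finset (Fin n × Fin n)),
        Real.exp (-2 * c a.1 a.2 * (x a.1 a.2 : ℝ)) / (Nat.factorial (x a.1 a.2) : ℝ)) = R
  obtain ⟨u, hu⟩ := Nat.exists_eq_add_of_le' hxpm
  obtain ⟨v, hv⟩ := Nat.exists_eq_add_of_le' hxkq
  rw [hu, hv]
  unfold exchRate
  generalize x k m = s
  generalize x p q = t
  simp only [Nat.add_sub_cancel, Nat.factorial_succ, Nat.cast_mul, Nat.cast_add, Nat.cast_one]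
  have key : Real.exp (-2 * c k m * ((s : ℝ) + 1)) * Real.exp (-2 * c p q * ((t : ℝ) + 1)) *
      Real.exp (-2 * c p m * (u : ℝ)) * Real.exp (-2 * c k q * (v : ℝ)) *
      Real.exp ((c k m + c p q) - (c p m + c k q)) =
      Real.exp (-2 * c k m * (s : ℝ)) * Real.exp (-2 * c p q * (t : ℝ)) *
      Real.exp (-2 * c p m * ((u : ℝ) + 1)) * Real.exp (-2 * c k q * ((v : ℝ) + 1)) *
      Real.exp ((c p m + c k q) - (c k m + c p q)) := by
    simp only [← Real.exp_add]
    congr 1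
    ring
  have hs : (s : ℝ) + 1 ≠ 0 := by positivity
  have ht : (t : ℝ) + 1 ≠ 0 := by positivity
  have hu' : (u : ℝ) + 1 ≠ 0 := by positivity
  have hv' : (v : ℝ) + 1 ≠ 0 := by positivity
  have e1 := Nat.cast_ne_zero (R := ℝ).mpr (Nat.factorial_ne_zero s)
  have e2 := Nat.cast_ne_zero (R := ℝ).mpr (Nat.factorial_ne_zero t)
  have e3 := Nat.cast_ne_zero (R := ℝ).mpr (Nat.factorial_ne_zero u)
  have e4 := Nat.cast_ne_zero (R := ℝ).mpr (Nat.factorial_ne_zero v)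
  generalize Real.exp (-2 * c k m * ((s : ℝ) + 1)) = A1 at *
  generalize Real.exp (-2 * c p q * ((t : ℝ) + 1)) = A2 at *
  generalize Real.exp (-2 * c p m * (u : ℝ)) = A3 at *
  generalize Real.exp (-2 * c k q * (v : ℝ)) = A4 at *
  generalize Real.exp ((c k m + c p q) - (c p m + c k q)) = A5 at *
  generalize Real.exp (-2 * c k m * (s : ℝ)) = B1 at *
  generalize Real.exp (-2 * c p q * (t : ℝ)) = B2 at *
  generalize Real.exp (-2 * c p m * ((u : ℝ) + 1)) = B3 at *
  generalize Real.exp (-2 * c k q * ((v : ℝ) + 1)) = B4 at *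
  generalize Real.exp ((c p m + c k q) - (c k m + c p q)) = B5 at *
  have l : ((s : ℝ) + 1) * ((t : ℝ) + 1) * (R * (A1 / (((s : ℝ) + 1) * (s.factorial : ℝ)) *
      (A2 / (((t : ℝ) + 1) * (t.factorial : ℝ)) * (A3 / (u.factorial : ℝ) *
      (A4 / (v.factorial : ℝ)))))) * (pL * A5) = R * pL * (A1 * A2 * A3 * A4 * A5) /
      ((s.factorial : ℝ) * t.factorial * u.factorial * v.factorial) := by
    field_simp
  have r : ((u : ℝ) + 1) * ((v : ℝ) + 1) * (R * (B1 / (s.factorial : ℝ) *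
      (B2 / (t.factorial : ℝ) * (B3 / (((u : ℝ) + 1) * (u.factorial : ℝ)) *
      (B4 / (((v : ℝ) + 1) * (v.factorial : ℝ))))))) * (pL * B5) =
      R * pL * (B1 * B2 * B3 * B4 * B5) /
      ((s.factorial : ℝ) * t.factorial * u.factorial * v.factorial) := by
    field_simp
  rw [l, r, key]
end

section
/- In the Beckmann route-flow setup, let g : P → ℝ be any vector and let x* ∈ X. Then the Wardrop complementarity condition — for every w ∈ W and every p ∈ P_w, x*_p · ( g_p − min_{q∈P_w} g_q ) = 0 — holds if and only if the variational inequality ⟨g, x − x*⟩ ≥ 0 holds for all x ∈ X. -/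
open Finset

/-- The feasible route-flow set `X`: nonnegative flows meeting each demand `d w`
on the class of routes `P_w = {p | part p = w}`. -/
def inX {P W : Type*} [Fintype P] [DecidableEq W]
    (part : P → W) (d : W → ℝ) (x : P → ℝ) : Prop :=
  (∀ p, 0 ≤ x p) ∧ ∀ w, ∑ p ∈ univ.filter (fun p => part p = w), x p = d w

theorem stmt_12 {P W : Type*} [Fintype P] [Fintype W] [DecidableEq W] [Nonempty P]
    (part : P → W)
    (hne : ∀ w : W, (univ.filter (fun p => part p = w)).Nonempty)
    (d : W → ℝ) (hd : ∀ w, 0 < d w)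
    (g : P → ℝ)
    (xs : P → ℝ) (hxs : inX part d xs) :
    (∀ w : W, ∀ p, part p = w →
        xs p * (g p - (univ.filter (fun q => part q = w)).inf' (hne w) g) = 0) ↔
      ∀ x : P → ℝ, inX part d x → 0 ≤ ∑ p, g p * (x p - xs p) := by
  classical
  set m : W → ℝ := fun w => (univ.filter (fun q => part q = w)).inf' (hne w) g with hm
  have hmle : ∀ p, 0 ≤ g p - m (part p) := by
    intro p
    have : m (part p) ≤ g p := Finset.inf'_le _ (by simp)
    linarith
  have key : ∀ x : P → ℝ, inX part d x →
      ∑ p, g p * (x p - xs p)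
        = ∑ p, (g p - m (part p)) * x p - ∑ p, xs p * (g p - m (part p)) := by
    intro x hx
    have h0 : ∀ y : P → ℝ, inX part d y → ∑ p, m (part p) * y p = ∑ w, m w * d w := by
      intro y hy
      rw [← Finset.sum_fiberwise (s := univ) (g := part)]
      refine Finset.sum_congr rfl fun w _ => ?_
      rw [← hy.2 w, Finset.mul_sum]
      refine Finset.sum_congr rfl fun p hp => ?_
      rw [(Finset.mem_filter.mp hp).2]
    have h1 : ∑ p, m (part p) * (x p - xs p) = 0 := by
      simp only [mul_sub, Finset.sum_sub_distrib]
      rw [h0 x hx, h0 xs hxs, sub_self]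
    rw [← Finset.sum_sub_distrib, ← sub_zero (∑ p, g p * (x p - xs p)), ← h1,
      ← Finset.sum_sub_distrib]
    exact Finset.sum_congr rfl fun p _ => by ring
  constructor
  · intro h x hx
    rw [key x hx, Finset.sum_eq_zero (f := fun p => xs p * (g p - m (part p)))
      (fun p _ => h (part p) p rfl), sub_zero]
    exact Finset.sum_nonneg fun p _ => mul_nonneg (hmle p) (hx.1 p)
  · intro h
    have hex : ∀ w, ∃ q, part q = w ∧ m w = g q := by
      intro w
      obtain ⟨q, hq, hq2⟩ := Finset.exists_mem_eq_inf' (hne w) g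
      exact ⟨q, (Finset.mem_filter.mp hq).2, hq2⟩
    choose q hq hqm using hex
    let x : P → ℝ := fun p => if p = q (part p) then d (part p) else 0
    have hx : inX part d x := by
      refine ⟨fun p => ?_, fun w => ?_⟩
      · by_cases hp : p = q (part p)
        · simp only [x]
          rw [if_pos hp]
          exact (hd _).le
        · simp only [x]
          rw [if_neg hp]
      · rw [Finset.sum_eq_single (q w)]
        · simp [x, hq]
        · intro p hp hpq
          have := (Finset.mem_filter.mp hp).2
          simp [x, this, hpq]
        · intro hn
          exact absurd (by simp [hq]) hn
    have h1 := h x hx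
    rw [key x hx, Finset.sum_eq_zero (f := fun p => (g p - m (part p)) * x p)] at h1
    · have hnn : ∀ p ∈ (univ : Finset P), 0 ≤ xs p * (g p - m (part p)) :=
        fun p _ => mul_nonneg (hxs.1 p) (hmle p)
      have hz := (Finset.sum_eq_zero_iff_of_nonneg hnn).1
        (le_antisymm (by linarith) (Finset.sum_nonneg hnn))
      intro w p hp
      subst hp
      exact hz p (mem_univ p)
    · intro p _
      by_cases hp : p = q (part p)
      · have : m (part p) = g p := (hqm (part p)).trans (congrArg g hp.symm)
        rw [this, sub_self, zero_mul]
      · simp only [x]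
        rw [if_neg hp, mul_zero]
end
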